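/- Fix odd primes p < q and a real ε > 0. Then there exists R such that for every integer r ≥ R all of whose odd prime divisors are at least p, one has E_1(pqr)/E(pqr) > (2^p − 2)/(p·2^q + 2^p − 2) − ε. -/

import Mathlib

open Polynomial

/-- The nonzero coefficients of `F`, read in order of increasing degree, alternate in sign:
any two nonzero coefficients with only zero coefficients strictly between them have
opposite signs. -/
def AltSigns (F : Polynomial ℤ) : Prop :=
  ∀ i j : ℕ, i < j → F.coeff i ≠ 0 → F.coeff j ≠ 0 →
    (∀ k, i < k → k < j → F.coeff k = 0) → F.coeff j = -F.coeff i

/-- `F` is a Reinhardt polynomial for `n`: `F(0) = 1`, `deg F < n`, every coefficient lies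
in `{-1, 0, 1}`, the nonzero coefficients read in order of increasing degree alternate in
sign beginning and ending with `+1` (so their number is odd), and `Φ_{2n} ∣ F`. -/
def IsReinhardt (n : ℕ) (F : Polynomial ℤ) : Prop :=
  F.coeff 0 = 1 ∧
  F.degree < (n : WithBot ℕ) ∧
  (∀ k, F.coeff k ∈ ({-1, 0, 1} : Set ℤ)) ∧
  AltSigns F ∧
  (∀ i, F.coeff i ≠ 0 → (∀ k, k < i → F.coeff k = 0) → F.coeff i = 1) ∧
  (∀ i, F.coeff i ≠ 0 → (∀ k, i < k → F.coeff k = 0) → F.coeff i = 1) ∧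
  Odd F.support.card ∧
  cyclotomic (2 * n) ℤ ∣ F

/-- The doubled coefficient sequence `u_F : ℤ/2nℤ → ℤ`: `u_F(k)` is the coefficient of
`z^k` in `F` for `0 ≤ k < n`, and `u_F(n + k) = -u_F(k)` for `0 ≤ k < n`. -/
def uF (n : ℕ) (F : Polynomial ℤ) (k : ZMod (2 * n)) : ℤ :=
  if k.val < n then F.coeff k.val else -F.coeff (k.val - n)

/-- `F` is `m`-antiperiodic: `u_F(k + m) = -u_F(k)` for all `k ∈ ℤ/2nℤ`. -/
def Antiper (n : ℕ) (F : Polynomial ℤ) (m : ℕ) : Prop :=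
  ∀ k : ZMod (2 * n), uF n F (k + (m : ZMod (2 * n))) = -uF n F k

/-- `F` is periodic: it is `(n/d)`-antiperiodic for some odd divisor `d > 1` of `n`. -/
def IsPeriodicR (n : ℕ) (F : Polynomial ℤ) : Prop :=
  ∃ d : ℕ, d ∣ n ∧ Odd d ∧ 1 < d ∧ Antiper n F (n / d)

/-- Dihedral equivalence of Reinhardt polynomials for `n`: `F'` is obtained from `F` by a
rotation `k ↦ k + c` or a reflection `k ↦ c - k` of the doubled coefficient sequence. -/
def REquiv (n : ℕ) (F F' : Polynomial ℤ) : Prop :=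
  ∃ c : ZMod (2 * n),
    (∀ k, uF n F' k = uF n F (k + c)) ∨ (∀ k, uF n F' k = uF n F (c - k))

/-- `E(n)`: the number of equivalence classes of Reinhardt polynomials for `n`. -/
noncomputable def En (n : ℕ) : ℕ :=
  Nat.card (Quot fun F F' : {F : Polynomial ℤ // IsReinhardt n F} => REquiv n F.1 F'.1)

/-- `E₁(n)`: the number of equivalence classes of Reinhardt polynomials for `n` all of whose
members are sporadic (i.e. not periodic). -/
noncomputable def E1 (n : ℕ) : ℕ :=
  Nat.card {C : Quot fun F F' : {F : Polynomial ℤ // IsReinhardt n F} => REquiv n F.1 F'.1 //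
    ∀ F, Quot.mk _ F = C → ¬IsPeriodicR n F.1}

/-! ### Reinhardt polynomials are determined by little data -/

lemma coeff_eq_of_support_eq {F F' : Polynomial ℤ} (hF0 : F.coeff 0 = 1) (hF0' : F'.coeff 0 = 1)
    (hF : AltSigns F) (hF' : AltSigns F') {M : ℕ}
    (h : ∀ k < M, F.coeff k ≠ 0 ↔ F'.coeff k ≠ 0) :
    ∀ k < M, F.coeff k = F'.coeff k := by
  intro k
  induction k using Nat.strong_induction_on with
  | _ k ih =>
    intro hk
    rcases Nat.eq_zero_or_pos k with rfl | hpos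
    · rw [hF0, hF0']
    by_cases hz : F.coeff k = 0
    · have := (h k hk).not
      push Not at this
      rw [hz, this.1 hz]
    have hz' := (h k hk).1 hz
    let S := (Finset.range k).filter fun i => F.coeff i ≠ 0
    have hS : S.Nonempty := ⟨0, by simp [S, hpos, hF0]⟩
    have hmem : S.max' hS ∈ S := S.max'_mem hS
    set i := S.max' hS with hi
    simp only [S, Finset.mem_filter, Finset.mem_range] at hmem
    have hgap : ∀ l, i < l → l < k → F.coeff l = 0 := by
      intro l hl hlk
      by_contra hne
      have : l ≤ i := S.le_max' l (by simp [S, hlk, hne])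
      omega
    have hgap' : ∀ l, i < l → l < k → F'.coeff l = 0 := by
      intro l hl hlk
      by_contra hne
      exact (h l (hlk.trans hk)).2 hne (hgap l hl hlk)
    rw [hF i k hmem.1 hmem.2 hz hgap,
      hF' i k hmem.1 ((h i (hmem.1.trans hk)).1 hmem.2) hz' hgap', ih i hmem.1 (hmem.1.trans hk)]

lemma IsReinhardt.coeff_eq_zero {n : ℕ} {F : Polynomial ℤ} (hF : IsReinhardt n F) {k : ℕ}
    (hk : n ≤ k) : F.coeff k = 0 :=
  coeff_eq_zero_of_degree_lt (hF.2.1.trans_le (by exact_mod_cast hk))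

lemma IsReinhardt.ext {n : ℕ} {F F' : Polynomial ℤ} (hF : IsReinhardt n F)
    (hF' : IsReinhardt n F') (h : ∀ k < n, F.coeff k = F'.coeff k) : F = F' := by
  ext k
  rcases lt_or_ge k n with hk | hk
  · exact h k hk
  · rw [hF.coeff_eq_zero hk, hF'.coeff_eq_zero hk]

instance (n : ℕ) : Finite {F : Polynomial ℤ // IsReinhardt n F} := by
  refine Finite.of_injective (β := Fin n → Bool) (fun F k => decide (F.1.coeff k ≠ 0)) ?_
  intro F F' h
  refine Subtype.ext (F.2.ext F'.2 (coeff_eq_of_support_eq F.2.1 F'.2.1 F.2.2.2.2.1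
    F'.2.2.2.2.1 fun k hk => ?_))
  exact decide_eq_decide.1 (congrFun h ⟨k, hk⟩)

lemma uF_natCast {n : ℕ} (F : Polynomial ℤ) {k : ℕ} (hk : k < n) :
    uF n F (k : ZMod (2 * n)) = F.coeff k := by
  have : (k : ZMod (2 * n)).val = k := ZMod.val_natCast_of_lt (by omega)
  simp [uF, this, hk]

lemma Antiper.coeff_add {n m : ℕ} {F : Polynomial ℤ} (h : Antiper n F m) {k : ℕ}
    (hk : k + m < n) : F.coeff (k + m) = -F.coeff k := by
  have := h (k : ZMod (2 * n))
  rwa [← Nat.cast_add, uF_natCast F hk, uF_natCast F (by omega)] at this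

lemma Antiper.coeff_eq {n m M : ℕ} {F F' : Polynomial ℤ} (hm : 0 < m) (hmM : m ≤ M)
    (h : Antiper n F m) (h' : Antiper n F' m) (heq : ∀ k < M, F.coeff k = F'.coeff k) :
    ∀ k < n, F.coeff k = F'.coeff k := by
  intro k
  induction k using Nat.strong_induction_on with
  | _ k ih =>
    intro hk
    rcases lt_or_ge k M with hkM | hkM
    · exact heq k hkM
    obtain ⟨l, rfl⟩ : ∃ l, k = l + m := ⟨k - m, by omega⟩
    rw [h.coeff_add hk, h'.coeff_add hk, ih l (by omega) (by omega)]

/-- If every odd divisor `d > 1` of `n` satisfies `n / d ≤ M`, there are at most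
`(n + 1) * 2 ^ M` periodic Reinhardt polynomials for `n`. -/
lemma card_periodic_le {n M : ℕ} (hn : 0 < n)
    (hM : ∀ d, d ∣ n → Odd d → 1 < d → n / d ≤ M) :
    Nat.card {F : {F : Polynomial ℤ // IsReinhardt n F} // IsPeriodicR n F.1}
      ≤ (n + 1) * 2 ^ M := by
  classical
  have hc : Nat.card (Fin (n + 1) × (Fin M → Bool)) = (n + 1) * 2 ^ M := by simp
  rw [← hc]
  choose d hd using fun F : {F : {F : Polynomial ℤ // IsReinhardt n F} // IsPeriodicR n F.1} => F.2
  refine Nat.card_le_card_of_injective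
    (fun F => (⟨n / d F, Nat.lt_succ_of_le (Nat.div_le_self _ _)⟩,
      fun k => decide (F.1.1.coeff k ≠ 0))) ?_
  intro F F' h
  simp only [Prod.mk.injEq, Fin.mk.injEq] at h
  obtain ⟨hdF, -, hdF1, hper⟩ := hd F
  obtain ⟨-, -, -, hper'⟩ := hd F'
  rw [← h.1] at hper'
  have hlow := coeff_eq_of_support_eq (M := M) F.1.2.1 F'.1.2.1 F.1.2.2.2.2.1 F'.1.2.2.2.2.1
    fun k hk => decide_eq_decide.1 (congrFun h.2 ⟨k, hk⟩)
  refine Subtype.ext (Subtype.ext (F.1.2.ext F'.1.2 ?_))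
  exact hper.coeff_eq (Nat.div_pos (Nat.le_of_dvd hn hdF) (by omega))
    (hM _ hdF (hd F).2.1 hdF1) hper' hlow

/-! ### Counting equivalence classes -/

lemma rEquiv_equivalence (n : ℕ) :
    Equivalence fun F F' : {F : Polynomial ℤ // IsReinhardt n F} => REquiv n F.1 F'.1 where
  refl F := ⟨0, Or.inl fun k => by simp⟩
  symm := by
    rintro F F' ⟨c, h | h⟩
    · exact ⟨-c, Or.inl fun k => by rw [h]; congr 1; ring⟩
    · exact ⟨c, Or.inr fun k => by rw [h]; congr 1; ring⟩
  trans := by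
    rintro F F' F'' ⟨c, h | h⟩ ⟨c', h' | h'⟩
    · exact ⟨c + c', Or.inl fun k => by rw [h', h]; congr 1; ring⟩
    · exact ⟨c + c', Or.inr fun k => by rw [h', h]; congr 1; ring⟩
    · exact ⟨c - c', Or.inr fun k => by rw [h', h]; congr 1; ring⟩
    · exact ⟨c - c', Or.inl fun k => by rw [h', h]; congr 1; ring⟩

lemma card_isReinhardt_le {n : ℕ} (hn : 0 < n) :
    Nat.card {F : Polynomial ℤ // IsReinhardt n F} ≤ 4 * n * En n := by
  have : NeZero (2 * n) := ⟨by omega⟩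
  let rel := fun F F' : {F : Polynomial ℤ // IsReinhardt n F} => REquiv n F.1 F'.1
  have hout : ∀ F, ∃ x : ZMod (2 * n) × Bool, ∀ k, uF n F.1 k =
      uF n (Quot.out (Quot.mk rel F)).1 (if x.2 then k + x.1 else x.1 - k) := by
    intro F
    have hrel : rel (Quot.out (Quot.mk rel F)) F :=
      ((rEquiv_equivalence n).quot_mk_eq_iff _ _).1 (Quot.out_eq (Quot.mk rel F))
    obtain ⟨c, h | h⟩ := hrel
    · exact ⟨(c, true), by simpa using h⟩
    · exact ⟨(c, false), by simpa using h⟩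
  choose x hx using hout
  have hc : Nat.card (Quot rel × (ZMod (2 * n) × Bool)) = 4 * n * En n := by
    rw [Nat.card_prod, Nat.card_prod, Nat.card_zmod, Nat.card_eq_fintype_card (α := Bool),
      Fintype.card_bool, show Nat.card (Quot rel) = En n from rfl]
    ring
  rw [← hc]
  refine Nat.card_le_card_of_injective (fun F => (Quot.mk rel F, x F)) ?_
  intro F F' h
  simp only [Prod.mk.injEq] at h
  refine Subtype.ext (F.2.ext F'.2 fun k hk => ?_)
  rw [← uF_natCast F.1 hk, ← uF_natCast F'.1 hk, hx F, hx F', h.1, h.2]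

lemma en_le_e1_add {n : ℕ} :
    En n ≤ E1 n +
      Nat.card {F : {F : Polynomial ℤ // IsReinhardt n F} // IsPeriodicR n F.1} := by
  classical
  let rel := fun F F' : {F : Polynomial ℤ // IsReinhardt n F} => REquiv n F.1 F'.1
  let P : Quot rel → Prop := fun C => ∀ F, Quot.mk _ F = C → ¬IsPeriodicR n F.1
  have hsum : En n = E1 n + Nat.card {C // ¬P C} := by
    rw [show En n = Nat.card (Quot rel) from rfl, ← Nat.card_congr (Equiv.sumCompl P),
      Nat.card_sum]
    rfl
  rw [hsum]
  gcongr
  have hex : ∀ C : {C // ¬P C}, ∃ F, Quot.mk rel F = C.1 ∧ IsPeriodicR n F.1 := by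
    rintro ⟨C, hC⟩
    simpa [P] using hC
  choose f hf hper using hex
  refine Nat.card_le_card_of_injective (fun C => ⟨f C, hper C⟩) ?_
  intro C C' h
  have : f C = f C' := congrArg Subtype.val h
  exact Subtype.ext (by rw [← hf C, ← hf C', this])

/-! ### Reinhardt polynomials from binary sequences -/

/-- The polynomial whose coefficients are the first `n` differences of `t`. -/
noncomputable def diffPoly (n : ℕ) (t : ℕ → ℤ) : Polynomial ℤ :=
  ∑ k ∈ Finset.range n, C (t (k + 1) - t k) * X ^ k

lemma coeff_diffPoly (n : ℕ) (t : ℕ → ℤ) (k : ℕ) :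
    (diffPoly n t).coeff k = if k < n then t (k + 1) - t k else 0 := by
  simp only [diffPoly, finsetSum_coeff, coeff_C_mul, coeff_X_pow]
  simp

lemma cyclotomic_dvd_diffPoly {n : ℕ} (hn : 0 < n) {t : ℕ → ℤ} (h : t n = 1 - t 0)
    (hz : ∀ ζ : ℂ, IsPrimitiveRoot ζ (2 * n) →
      ∑ k ∈ Finset.range n, (2 * t k - 1 : ℂ) * ζ ^ k = 0) :
    cyclotomic (2 * n) ℤ ∣ diffPoly n t := by
  have hζ := Complex.isPrimitiveRoot_exp (2 * n) (by omega)
  set ζ := Complex.exp (2 * Real.pi * Complex.I / ((2 * n : ℕ) : ℂ))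
  rw [cyclotomic_eq_minpoly hζ (by omega)]
  refine minpoly.isIntegrallyClosed_dvd (hζ.isIntegral (by omega)) ?_
  have hζn : ζ ^ n = -1 := by
    have h2 := hζ.pow_of_dvd (p := n) (by omega) (dvd_mul_left n 2)
    rw [Nat.mul_div_cancel _ hn] at h2
    exact h2.eq_neg_one_of_two_right
  have hG := hz ζ hζ
  have hshift : ∑ k ∈ Finset.range n, (2 * t (k + 1) - 1 : ℂ) * ζ ^ (k + 1) = 0 := by
    have h1 := Finset.sum_range_succ (fun k => (2 * t k - 1 : ℂ) * ζ ^ k) n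
    rw [Finset.sum_range_succ', hG, hζn, h] at h1
    push_cast at h1
    linear_combination h1
  have hev : aeval ζ (diffPoly n t) =
      ∑ k ∈ Finset.range n, ((t (k + 1) : ℂ) - t k) * ζ ^ k := by
    simp [diffPoly, map_sum]
  have hmul : 2 * ζ * aeval ζ (diffPoly n t) = 0 := by
    calc 2 * ζ * aeval ζ (diffPoly n t)
        = ∑ k ∈ Finset.range n, (2 * t (k + 1) - 1 : ℂ) * ζ ^ (k + 1)
          - ζ * ∑ k ∈ Finset.range n, (2 * t k - 1 : ℂ) * ζ ^ k := by
          rw [hev, Finset.mul_sum, Finset.mul_sum, ← Finset.sum_sub_distrib]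
          exact Finset.sum_congr rfl fun k _ => by ring
      _ = 0 := by rw [hshift, hG]; ring
  have hζ0 : ζ ≠ 0 := hζ.ne_zero (by omega)
  simpa [hζ0] using hmul

lemma isReinhardt_diffPoly {n : ℕ} (hn : 0 < n) {t : ℕ → ℤ} (hv : ∀ k, t k = 0 ∨ t k = 1)
    (h0 : t 0 = 0) (h1 : t 1 = 1) (h : t n = 1)
    (hz : ∀ ζ : ℂ, IsPrimitiveRoot ζ (2 * n) →
      ∑ k ∈ Finset.range n, (2 * t k - 1 : ℂ) * ζ ^ k = 0) :
    IsReinhardt n (diffPoly n t) := by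
  have hc := coeff_diffPoly n t
  have hlt : ∀ {k}, (diffPoly n t).coeff k ≠ 0 → k < n := by
    intro k hk
    by_contra hne
    exact hk (by rw [hc, if_neg hne])
  have hconst : ∀ i j, i ≤ j → j ≤ n → (∀ k, i ≤ k → k < j → (diffPoly n t).coeff k = 0) →
      t j = t i := by
    intro i j hij
    induction j, hij using Nat.le_induction with
    | base => intros; rfl
    | succ j hij ih =>
      intro hjn hk
      have := hk j hij (by omega)
      rw [hc, if_pos (by omega)] at this
      rw [← ih (by omega) fun k hk1 hk2 => hk k hk1 (by omega)]
      omega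
  have hcoeff0 : (diffPoly n t).coeff 0 = 1 := by simp [hc, hn, h0, h1]
  have hdeg : (diffPoly n t).degree < (n : WithBot ℕ) := by
    rw [degree_lt_iff_coeff_zero]
    intro m hm
    rw [hc, if_neg (by omega)]
  have hval : ∀ k, (diffPoly n t).coeff k ∈ ({-1, 0, 1} : Set ℤ) := by
    intro k
    simp only [hc, Set.mem_insert_iff, Set.mem_singleton_iff]
    have := hv k
    have := hv (k + 1)
    split_ifs <;> omega
  refine ⟨hcoeff0, hdeg, hval, ?_, ?_, ?_, ?_,
    cyclotomic_dvd_diffPoly hn (by rw [h, h0]; rfl) hz⟩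
  · intro i j hij hi hj hk
    have hin := hlt hi
    have hjn := hlt hj
    have := hconst (i + 1) j hij hjn.le fun k hk1 hk2 => hk k hk1 hk2
    rw [hc, if_pos hin] at hi
    rw [hc, if_pos hjn] at hj
    rw [hc i, hc j, if_pos hin, if_pos hjn]
    have := hv i
    have := hv (i + 1)
    have := hv (j + 1)
    omega
  · intro i hi hk
    rcases Nat.eq_zero_or_pos i with rfl | hi0
    · exact hcoeff0
    · have := hk 0 hi0
      omega
  · intro i hi hk
    have hin := hlt hi
    have := hconst (i + 1) n hin le_rfl fun k hk1 _ => hk k hk1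
    rw [hc, if_pos hin] at hi ⊢
    have := hv i
    omega
  · have hsum : ∑ k ∈ (diffPoly n t).support, (diffPoly n t).coeff k = 1 := by
      have : ∑ k ∈ Finset.range n, (diffPoly n t).coeff k = 1 := by
        rw [Finset.sum_congr rfl fun k hk => by rw [hc, if_pos (Finset.mem_range.1 hk)],
          Finset.sum_range_sub, h, h0]
        rfl
      rw [← this]
      refine Finset.sum_subset (fun k hk => ?_) (fun k _ hk => ?_)
      · exact Finset.mem_range.2 (hlt (mem_support_iff.1 hk))
      · exact notMem_support_iff.1 hk
    have hcast := congrArg (Int.cast : ℤ → ZMod 2) hsum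
    rw [Int.cast_sum, Finset.sum_congr rfl (g := fun _ => 1)] at hcast
    · rw [← ZMod.natCast_eq_one_iff_odd]
      simpa using hcast
    · intro k hk
      have hk1 := hval k
      have hk2 := mem_support_iff.1 hk
      simp only [Set.mem_insert_iff, Set.mem_singleton_iff] at hk1
      rcases hk1 with hk1 | hk1 | hk1
      · rw [hk1]; decide
      · exact absurd hk1 hk2
      · rw [hk1]; decide

lemma eq_of_diffPoly_eq {n : ℕ} {t t' : ℕ → ℤ} (h0 : t 0 = t' 0)
    (h : diffPoly n t = diffPoly n t') : ∀ k < n, t k = t' k := by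
  intro k
  induction k with
  | zero => exact fun _ => h0
  | succ k ih =>
    intro hk
    have := congrArg (fun F => F.coeff k) h
    simp only [coeff_diffPoly, if_pos (show k < n by omega)] at this
    have := ih (by omega)
    omega

/-! ### Interleaving antiperiodic words -/

lemma add_odd_mul_eq_one_sub {f : ℕ → ℤ} {m d : ℕ} (hf : ∀ j, f (j + m) = 1 - f j) (hd : Odd d)
    (j : ℕ) : f (j + d * m) = 1 - f j := by
  obtain ⟨a, rfl⟩ := hd
  induction a with
  | zero => simpa using hf j
  | succ a ih =>
    rw [show j + (2 * (a + 1) + 1) * m = j + (2 * a + 1) * m + m + m by ring, hf, hf, ih]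
    ring

lemma sum_range_mul {M : Type*} [AddCommMonoid M] (f : ℕ → M) (a b : ℕ) :
    ∑ k ∈ Finset.range (a * b), f k =
      ∑ i ∈ Finset.range b, ∑ j ∈ Finset.range a, f (i + b * j) := by
  rw [Finset.sum_comm]
  induction a with
  | zero => simp
  | succ a ih =>
    rw [Finset.sum_range_succ, ← ih, Nat.succ_mul, Finset.sum_range_add]
    congr 1
    exact Finset.sum_congr rfl fun i _ => by congr 1; ring

/-- An antiperiodic word with antiperiod `q` is annihilated by a suitable root of unity. -/
lemma sum_antiperiodic_eq_zero {f : ℕ → ℤ} {p q : ℕ} (hq : 0 < q) (hp : Odd p) (hp1 : 1 < p)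
    (hf : ∀ j, f (j + q) = 1 - f j) {ξ : ℂ} (hξ : IsPrimitiveRoot ξ (2 * (p * q))) :
    ∑ j ∈ Finset.range (p * q), (2 * f j - 1 : ℂ) * ξ ^ j = 0 := by
  have hpq : 0 < p * q := Nat.mul_pos (by omega) hq
  have hpow : ∀ b a, (2 * f (b + q * a) - 1 : ℂ) * ξ ^ (b + q * a)
      = (2 * f b - 1) * ξ ^ b * (-ξ ^ q) ^ a := by
    intro b a
    induction a with
    | zero => simp
    | succ a ih =>
      rw [pow_succ, ← mul_assoc, ← ih, show b + q * (a + 1) = b + q * a + q by ring, hf]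
      push_cast
      ring
  have hne : -ξ ^ q ≠ 1 := by
    intro h
    have h1 : ξ ^ (2 * q) = 1 := by
      rw [show 2 * q = q * 2 by ring, pow_mul]
      linear_combination (ξ ^ q - 1) * (-1) * h
    have h2 := Nat.le_of_dvd (by omega) (hξ.dvd_of_pow_eq_one _ h1)
    nlinarith
  have hone : (-ξ ^ q) ^ p = 1 := by
    have h2 := hξ.pow_of_dvd (p := p * q) (by omega) (dvd_mul_left _ 2)
    rw [Nat.mul_div_cancel _ hpq] at h2
    rw [hp.neg_pow, ← pow_mul, mul_comm q p, h2.eq_neg_one_of_two_right]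
    ring
  have hgeom : ∑ a ∈ Finset.range p, (-ξ ^ q) ^ a = 0 := by
    rw [geom_sum_eq hne, hone]
    simp
  rw [sum_range_mul]
  refine Finset.sum_eq_zero fun b _ => ?_
  simp only [hpow, ← Finset.mul_sum, hgeom, mul_zero]

/-- The sequence whose restriction to the residue class `i` modulo `r` is the word `c i`. -/
def interleave (r : ℕ) (c : ℕ → ℕ → ℤ) (k : ℕ) : ℤ := c (k % r) (k / r)

lemma interleave_add_mul {r i : ℕ} (hi : i < r) (c : ℕ → ℕ → ℤ) (j : ℕ) :
    interleave r c (i + r * j) = c i j := by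
  have hr : 0 < r := by omega
  simp [interleave, Nat.add_mul_div_left _ _ hr, Nat.div_eq_of_lt hi, Nat.mod_eq_of_lt hi]

lemma isReinhardt_interleave {p q r : ℕ} (hp : Odd p) (hq : Odd q) (hp1 : 1 < p) (hq1 : 1 < q)
    (hr : 2 ≤ r) {c : ℕ → ℕ → ℤ} (hv : ∀ i j, c i j = 0 ∨ c i j = 1)
    (hc : ∀ i, (∀ j, c i (j + q) = 1 - c i j) ∨ (∀ j, c i (j + p) = 1 - c i j))
    (h0 : c 0 0 = 0) (h1 : c 1 0 = 1) :
    IsReinhardt (p * q * r) (diffPoly (p * q * r) (interleave r c)) := by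
  have hpq : 0 < p * q := Nat.mul_pos (by omega) (by omega)
  refine isReinhardt_diffPoly (Nat.mul_pos hpq (by omega)) (fun k => hv _ _) ?_ ?_ ?_ ?_
  · simpa [interleave] using h0
  · simpa [interleave, Nat.mod_eq_of_lt (show 1 < r by omega),
      Nat.div_eq_of_lt (show 1 < r by omega)] using h1
  · have := interleave_add_mul (show 0 < r by omega) c (p * q)
    rw [zero_add, mul_comm r] at this
    rw [this]
    rcases hc 0 with h | h
    · simpa [h0] using add_odd_mul_eq_one_sub h hp 0
    · simpa [h0, mul_comm] using add_odd_mul_eq_one_sub h hq 0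
  · intro ζ hζ
    have hξ : IsPrimitiveRoot (ζ ^ r) (2 * (p * q)) :=
      hζ.pow (Nat.mul_pos two_pos (Nat.mul_pos hpq (by omega))) (by ring)
    rw [sum_range_mul]
    refine Finset.sum_eq_zero fun i hi => ?_
    have key : ∑ j ∈ Finset.range (p * q), (2 * c i j - 1 : ℂ) * (ζ ^ r) ^ j = 0 := by
      rcases hc i with h | h
      · exact sum_antiperiodic_eq_zero (by omega) hp hp1 h hξ
      · rw [mul_comm p q] at hξ ⊢
        exact sum_antiperiodic_eq_zero (by omega) hq hq1 h hξ
    calc _ = ∑ j ∈ Finset.range (p * q), ζ ^ i * ((2 * c i j - 1 : ℂ) * (ζ ^ r) ^ j) := by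
          refine Finset.sum_congr rfl fun j _ => ?_
          rw [interleave_add_mul (Finset.mem_range.1 hi), pow_add, pow_mul]
          ring
      _ = 0 := by rw [← Finset.mul_sum, key, mul_zero]

/-- The `q`-antiperiodic binary word with prescribed first `q` letters, or the word made of
alternating constant runs of length `p`. -/
def antiWord (p q : ℕ) [NeZero q] : Option (Fin q → Fin 2) → ℕ → ℤ
  | some b, j => ((j / q + b (Fin.ofNat q j) : ℕ) % 2 : ℕ)
  | none, j => (j / p % 2 : ℕ)

lemma antiWord_eq_zero_or_one (p q : ℕ) [NeZero q] (x : Option (Fin q → Fin 2)) (j : ℕ) :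
    antiWord p q x j = 0 ∨ antiWord p q x j = 1 := by
  cases x <;> simp only [antiWord] <;> omega

lemma antiWord_some_add (p q : ℕ) [NeZero q] (b : Fin q → Fin 2) (j : ℕ) :
    antiWord p q (some b) (j + q) = 1 - antiWord p q (some b) j := by
  have hq : 0 < q := Nat.pos_of_ne_zero (NeZero.ne q)
  have : Fin.ofNat q (j + q) = Fin.ofNat q j := by simp [Fin.ofNat]
  simp only [antiWord, this, Nat.add_div_right _ hq]
  omega

lemma antiWord_none_add {p : ℕ} (hp : 0 < p) (q : ℕ) [NeZero q] (j : ℕ) :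
    antiWord p q none (j + p) = 1 - antiWord p q none j := by
  simp only [antiWord, Nat.add_div_right _ hp]
  omega

lemma antiWord_none_ne_some {p q : ℕ} [NeZero q] (hp : 0 < p) (hpq : ¬p ∣ q) (b : Fin q → Fin 2) :
    ∃ j < q + p, antiWord p q none j ≠ antiWord p q (some b) j := by
  by_contra! h
  have hmod : 0 < q % p := Nat.pos_of_ne_zero fun h0 => hpq (Nat.dvd_of_mod_eq_zero h0)
  have hlt : q % p < p := Nat.mod_lt _ hp
  have hdiv := Nat.div_add_mod q p
  have hanti : ∀ j < p, antiWord p q none (j + q) = 1 - antiWord p q none j := by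
    intro j hj
    rw [h _ (by omega), h _ (by omega), antiWord_some_add]
  have hs := hanti (p - q % p) (by omega)
  have h0 := hanti 0 hp
  have e1 : (p - q % p) / p = 0 := Nat.div_eq_of_lt (by omega)
  have e2 : (p - q % p + q) / p = q / p + 1 := by
    rw [show p - q % p + q = p * (q / p + 1) by rw [mul_add]; omega, Nat.mul_div_cancel_left _ hp]
  simp only [antiWord, e1, e2, zero_add, Nat.zero_div] at hs h0
  omega

lemma antiWord_injOn {p q : ℕ} [NeZero q] (hp : 0 < p) (hpq : ¬p ∣ q)
    {x y : Option (Fin q → Fin 2)} (h : ∀ j < q + p, antiWord p q x j = antiWord p q y j) :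
    x = y := by
  rcases x with _ | b <;> rcases y with _ | b'
  · rfl
  · obtain ⟨j, hj, hne⟩ := antiWord_none_ne_some hp hpq b'
    exact absurd (h j hj) hne
  · obtain ⟨j, hj, hne⟩ := antiWord_none_ne_some hp hpq b
    exact absurd (h j hj).symm hne
  · congr 1
    ext j
    have := h j (by omega)
    simp only [antiWord, Nat.div_eq_of_lt j.2, Fin.ofNat_val_eq_self] at this
    omega

/-- Interleaving two fixed alternating words with arbitrary antiperiodic words. -/
def wordFamily (p q r : ℕ) [NeZero q] (g : Fin r → Option (Fin q → Fin 2)) : ℕ → ℕ → ℤ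
  | 0, j => (j % 2 : ℕ)
  | 1, j => ((j + 1) % 2 : ℕ)
  | i + 2, j => if h : i < r then antiWord p q (g ⟨i, h⟩) j else (j % 2 : ℕ)

lemma wordFamily_eq_zero_or_one (p q r : ℕ) [NeZero q] (g : Fin r → Option (Fin q → Fin 2))
    (i j : ℕ) : wordFamily p q r g i j = 0 ∨ wordFamily p q r g i j = 1 := by
  match i with
  | 0 | 1 => simp only [wordFamily]; omega
  | i + 2 =>
    simp only [wordFamily]
    split_ifs
    · exact antiWord_eq_zero_or_one _ _ _ _
    · omega

lemma wordFamily_antiperiodic {p q : ℕ} [NeZero q] (hp : 0 < p) (hq : Odd q) (r : ℕ)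
    (g : Fin r → Option (Fin q → Fin 2)) (i : ℕ) :
    (∀ j, wordFamily p q r g i (j + q) = 1 - wordFamily p q r g i j) ∨
      (∀ j, wordFamily p q r g i (j + p) = 1 - wordFamily p q r g i j) := by
  obtain ⟨a, ha⟩ := hq
  match i with
  | 0 | 1 => left; intro j; simp only [wordFamily]; omega
  | i + 2 =>
    by_cases h : i < r
    · simp only [wordFamily, dif_pos h]
      cases g ⟨i, h⟩ with
      | none => exact Or.inr (antiWord_none_add hp q)
      | some b => exact Or.inl (antiWord_some_add p q b)
    · left; intro j; simp only [wordFamily, dif_neg h]; omega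

lemma le_card_isReinhardt {p q : ℕ} (hp : Odd p) (hq : Odd q) (hp1 : 1 < p) (hq1 : 1 < q)
    (hpq : ¬p ∣ q) (r : ℕ) :
    (2 ^ q + 1) ^ r ≤
      Nat.card {F : Polynomial ℤ // IsReinhardt (p * q * (r + 2)) F} := by
  have : NeZero q := ⟨by omega⟩
  have hc : Nat.card (Fin r → Option (Fin q → Fin 2)) = (2 ^ q + 1) ^ r := by
    simp [Nat.card_eq_fintype_card]
  rw [← hc]
  refine Nat.card_le_card_of_injective (fun g => ⟨_, isReinhardt_interleave hp hq hp1 hq1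
    (show 2 ≤ r + 2 by omega) (wordFamily_eq_zero_or_one p q r g)
    (wordFamily_antiperiodic (by omega) hq r g) rfl rfl⟩) ?_
  intro g g' h
  have heq := eq_of_diffPoly_eq (by simp [interleave, wordFamily]) (congrArg Subtype.val h)
  funext i
  refine antiWord_injOn (p := p) (by omega) hpq fun j hj => ?_
  have hle : q + p ≤ p * q := by nlinarith
  have hbound : (i + 2 : ℕ) + (r + 2) * j < p * q * (r + 2) := by
    have : (j + 1) * (r + 2) ≤ p * q * (r + 2) := Nat.mul_le_mul_right _ (by omega)
    have := i.2
    nlinarith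
  have := heq _ hbound
  rw [interleave_add_mul (by omega), interleave_add_mul (by omega)] at this
  simpa [wordFamily] using this

/-! ### The proportion of sporadic classes -/

lemma one_sub_le_e1_div_en {n M N : ℕ} (hn : 0 < n) (hN : 0 < N)
    (hM : ∀ d, d ∣ n → Odd d → 1 < d → n / d ≤ M)
    (hcard : N ≤ Nat.card {F : Polynomial ℤ // IsReinhardt n F}) :
    1 - 4 * n * ((n + 1) * 2 ^ M) / (N : ℝ) ≤ (E1 n : ℝ) / En n := by
  have h1 : (N : ℝ) ≤ 4 * n * En n := by exact_mod_cast hcard.trans (card_isReinhardt_le hn)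
  have h2 : (En n : ℝ) ≤ E1 n + (n + 1) * 2 ^ M := by
    exact_mod_cast en_le_e1_add.trans (Nat.add_le_add_left (card_periodic_le hn hM) _)
  have hNpos : (0 : ℝ) < N := by exact_mod_cast hN
  have hEn : (0 : ℝ) < En n := by
    by_contra hle
    have : (En n : ℝ) = 0 := le_antisymm (not_lt.1 hle) (Nat.cast_nonneg _)
    rw [this] at h1
    linarith
  have h3 : ((n + 1) * 2 ^ M : ℝ) / En n ≤ 4 * n * ((n + 1) * 2 ^ M) / N := by
    rw [div_le_div_iff₀ hEn hNpos]
    have : (0 : ℝ) ≤ (n + 1) * 2 ^ M := by positivity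
    nlinarith
  have h4 : 1 - ((n + 1) * 2 ^ M : ℝ) / En n ≤ (E1 n : ℝ) / En n := by
    rw [sub_le_iff_le_add, ← add_div, le_div_iff₀ hEn]
    linarith
  linarith

open Filter Topology in
lemma tendsto_periodic_bound (p q : ℕ) :
    Tendsto (fun r : ℕ => 4 * ((p * q * r : ℕ) : ℝ) * (((p * q * r : ℕ) + 1) * 2 ^ (q * r)) /
      (((2 ^ q + 1) ^ (r - 2) : ℕ) : ℝ)) atTop (𝓝 0) := by
  set x : ℝ := 2 ^ q / (2 ^ q + 1)
  have hx0 : 0 ≤ x := by positivity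
  have hx1 : x < 1 := by
    rw [div_lt_one (by positivity)]
    linarith
  have h2 := (tendsto_pow_const_mul_const_pow_of_lt_one 2 hx0 hx1).const_mul
    (4 * (p * q) ^ 2 * (2 ^ q + 1) ^ 2 : ℝ)
  have h1 := (tendsto_pow_const_mul_const_pow_of_lt_one 1 hx0 hx1).const_mul
    (4 * (p * q) * (2 ^ q + 1) ^ 2 : ℝ)
  have h := h2.add h1
  simp only [mul_zero, add_zero] at h
  refine h.congr' ?_
  filter_upwards [eventually_ge_atTop 2] with r hr
  obtain ⟨s, rfl⟩ : ∃ s, r = s + 2 := ⟨r - 2, by omega⟩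
  have hpos : (2 ^ q + 1 : ℝ) ≠ 0 := by positivity
  simp only [Nat.add_sub_cancel, x, div_pow]
  push_cast
  rw [pow_mul, pow_add (2 ^ q + 1 : ℝ) s 2]
  field_simp

/-- Fix odd primes `p < q` and `ε > 0`.  For all sufficiently large `r`
having no odd prime divisor less than `p`,
`E₁(pqr)/E(pqr) > (2^p - 2)/(p·2^q + 2^p - 2) - ε`. -/
theorem sporadic_positive_proportion (p q : ℕ) (hp : p.Prime) (hq : q.Prime) (hop : Odd p)
    (hoq : Odd q) (hlt : p < q) (ε : ℝ) (hε : 0 < ε) :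
    ∃ R : ℕ, ∀ r : ℕ, R ≤ r →
      (∀ ℓ : ℕ, ℓ.Prime → Odd ℓ → ℓ ∣ r → p ≤ ℓ) →
      (E1 (p * q * r) : ℝ) / (En (p * q * r))
        > ((2 : ℝ) ^ p - 2) / ((p : ℝ) * 2 ^ q + 2 ^ p - 2) - ε := by
  have hp1 := hp.one_lt
  have hpq : ¬p ∣ q := fun h => by
    rcases (Nat.dvd_prime hq).1 h with h | h <;> omega
  obtain ⟨R, hR⟩ := Filter.eventually_atTop.1
    ((tendsto_periodic_bound p q).eventually (gt_mem_nhds hε))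
  refine ⟨R + 2, fun r hr hdiv => ?_⟩
  have hn : 0 < p * q * r := Nat.mul_pos (Nat.mul_pos hp.pos hq.pos) (by omega)
  have hM : ∀ d, d ∣ p * q * r → Odd d → 1 < d → p * q * r / d ≤ q * r := by
    intro d hd hodd hd1
    have hpr := Nat.minFac_prime hd1.ne'
    have hdvd := Nat.minFac_dvd d
    have hle : p ≤ d.minFac := by
      rcases hpr.dvd_mul.1 (hdvd.trans hd) with h | h
      · rcases hpr.dvd_mul.1 h with h | h
        · exact ((Nat.prime_dvd_prime_iff_eq hpr hp).1 h).ge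
        · rw [(Nat.prime_dvd_prime_iff_eq hpr hq).1 h]
          exact hlt.le
      · exact hdiv _ hpr (hodd.of_dvd_nat hdvd) h
    have hpd : p ≤ d := hle.trans (Nat.minFac_le (by omega))
    refine Nat.div_le_of_le_mul ?_
    rw [mul_assoc]
    exact Nat.mul_le_mul_right _ hpd
  have hcard : (2 ^ q + 1) ^ (r - 2) ≤
      Nat.card {F : Polynomial ℤ // IsReinhardt (p * q * r) F} := by
    have := le_card_isReinhardt hop hoq hp1 hq.one_lt hpq (r - 2)
    rwa [Nat.sub_add_cancel (by omega)] at this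
  have hmain := one_sub_le_e1_div_en hn (by positivity) hM hcard
  have hsmall := hR r (by omega)
  have hle : ((2 : ℝ) ^ p - 2) / ((p : ℝ) * 2 ^ q + 2 ^ p - 2) ≤ 1 := by
    have h2 : (2 : ℝ) ^ 1 ≤ 2 ^ p := pow_le_pow_right₀ one_le_two hp1.le
    have h3 : (0 : ℝ) < p * 2 ^ q := by
      have := hp.pos
      positivity
    rw [div_le_one (by linarith)]
    linarith
  linarith
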